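/- Let χ be the substitution on {a,b} with χ(a) = aab and χ(b) = abb, and let X_χ be its substitution subshift. For every continuous function p : X_χ → {1,2,3,...} such that S(x) = σ^{p(x)}(x) is a homeomorphism of X_χ, every S-orbit is dense in X_χ, and every σ-orbit is the union of exactly 2 distinct S-orbits (orbit number c = 2): if (X_χ, S) is topologically conjugate to the closure of the σ-orbit of some Toeplitz sequence over some finite alphabet, then (X_χ, S) is topologically conjugate to (X_χ, σ²). -/

import Mathlib

open Set Topology Classical

noncomputable section

/-- The left shift `σ` on bi-infinite sequences: `(σ x) n = x (n+1)`. -/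
def shiftMap {A : Type} (x : ℤ → A) : ℤ → A := fun n => x (n + 1)

/-- The shift by an integer amount: `shiftZ n x = σ^n x`. -/
def shiftZ {A : Type} (n : ℤ) (x : ℤ → A) : ℤ → A := fun m => x (m + n)

/-- A bi-infinite sequence is Toeplitz if every coordinate is periodically repeated. -/
def IsToeplitz {A : Type} (x : ℤ → A) : Prop :=
  ∀ i : ℤ, ∃ p : ℕ, 0 < p ∧ ∀ k : ℤ, x (i + k * (p : ℤ)) = x i

/-- The closure of the full shift orbit of `x`. -/
def orbitClosure {A : Type} [TopologicalSpace A] (x : ℤ → A) : Set (ℤ → A) :=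
  closure {y | ∃ n : ℤ, shiftZ n x = y}

/-- The finite word `x_i x_{i+1} ⋯ x_{i+n-1}`. -/
def seqWord {A : Type} (x : ℤ → A) (i : ℤ) (n : ℕ) : List A :=
  List.ofFn fun m : Fin n => x (i + (m : ℕ))

/-- Iterates `θ^k` of a substitution, applied to a letter. -/
def substPow {A : Type} (θ : A → List A) : ℕ → A → List A
  | 0, a => [a]
  | k + 1, a => (θ a).flatMap (substPow θ k)

/-- The substitution subshift of `θ`: all sequences whose finite subwords occur in
some `θ^k(a)`. -/
def substShift {A : Type} (θ : A → List A) : Set (ℤ → A) :=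
  {x | ∀ i : ℤ, ∀ n : ℕ, ∃ (k : ℕ) (a : A), (seqWord x i n).IsInfix (substPow θ k a)}

/-- The full orbit of `x` under an (invertible) map `S`, within the set `X`. -/
def orbitIn {α : Type} (S : α → α) (X : Set α) (x : α) : Set α :=
  {y | y ∈ X ∧ ∃ n : ℕ, S^[n] x = y ∨ S^[n] y = x}

/-- Every `S`-orbit within `X` is dense in `X`. -/
def MinimalOn {α : Type} [TopologicalSpace α] (S : α → α) (X : Set α) : Prop :=
  ∀ x ∈ X, X ⊆ closure (orbitIn S X x)

/-- Every `T`-orbit in `X` is the union of exactly `c` distinct `S`-orbits. -/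
def OrbitNumberOn {α : Type} (T S : α → α) (X : Set α) (c : ℕ) : Prop :=
  ∀ x ∈ X, ∃ r : Fin c → α,
    (∀ i, r i ∈ orbitIn T X x) ∧
    (∀ i j, i ≠ j → r j ∉ orbitIn S X (r i)) ∧
    (∀ y ∈ orbitIn T X x, ∃ i, y ∈ orbitIn S X (r i))

/-- `S` restricts to a homeomorphism of the subset `X`. -/
def RestrictsToHomeomorph {α : Type} [TopologicalSpace α] (S : α → α) (X : Set α) : Prop :=
  ∃ e : X ≃ₜ X, ∀ x : X, (e x : α) = S (x : α)

/-- The systems `(X, S)` and `(Y, R)` are topologically conjugate. -/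
def TopConj {α β : Type} [TopologicalSpace α] [TopologicalSpace β]
    (X : Set α) (S : α → α) (Y : Set β) (R : β → β) : Prop :=
  ∃ (hS : Set.MapsTo S X X) (hR : Set.MapsTo R Y Y) (h : X ≃ₜ Y),
    ∀ x : X, h (Set.MapsTo.restrict S X X hS x) = Set.MapsTo.restrict R Y Y hR (h x)

/-- `(Y, R)` is a topological factor of `(X, S)`. -/
def IsFactorOn {α β : Type} [TopologicalSpace α] [TopologicalSpace β]
    (X : Set α) (S : α → α) (Y : Set β) (R : β → β) : Prop :=
  ∃ F : α → β, Set.MapsTo F X Y ∧ ContinuousOn F X ∧ Set.SurjOn F X Y ∧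
    ∀ x ∈ X, F (S x) = R (F x)

/-- `(X, S)` is a Toeplitz flow: it is topologically conjugate to the orbit closure of
some Toeplitz sequence over some finite alphabet, with the shift map. -/
def IsToeplitzFlow {α : Type} [TopologicalSpace α] (X : Set α) (S : α → α) : Prop :=
  ∃ (B : Type) (_ : Fintype B) (z : ℤ → B), IsToeplitz z ∧
    (letI : TopologicalSpace B := ⊥
     TopConj X S (orbitClosure z) shiftMap)

/-- `Per_p(x)`: the set of positions where `x` is periodic with period `p`. -/
def PerSet {A : Type} (x : ℤ → A) (p : ℕ) : Set ℤ :=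
  {k | ∀ n : ℤ, x (k + n * (p : ℤ)) = x k}

/-- `p` is an essential period of `x`. -/
def IsEssentialPeriod {A : Type} (x : ℤ → A) (p : ℕ) : Prop :=
  0 < p ∧ ¬ ∃ q : ℕ, 0 < q ∧ q < p ∧
    ((fun k => k + (q : ℤ)) '' PerSet x p = PerSet x p) ∧
    (∀ k ∈ PerSet x p, x (k + (q : ℤ)) = x k)

/-- A period structure for a Toeplitz sequence `x`. -/
def IsPeriodStructure {A : Type} (x : ℤ → A) (p : ℕ → ℕ) : Prop :=
  StrictMono p ∧ (∀ k, IsEssentialPeriod x (p k)) ∧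
  (∀ k, p k ∣ p (k + 1)) ∧ (⋃ k, PerSet x (p k)) = Set.univ

/-- `x` is a (σ-)periodic sequence. -/
def IsPeriodicSeq {A : Type} (x : ℤ → A) : Prop :=
  ∃ n : ℕ, 0 < n ∧ ∀ m : ℤ, x (m + (n : ℤ)) = x m

/-- `z` is the bi-infinite concatenation of the `ψ`-images of the letters of `y`,
with `ψ(y₀)` beginning at coordinate `0`. -/
def IsConcat {B C : Type} (ψ : B → List C) (y : ℤ → B) (z : ℤ → C) : Prop :=
  ∃ s : ℤ → ℤ, s 0 = 0 ∧
    (∀ n : ℤ, s (n + 1) = s n + ((ψ (y n)).length : ℤ)) ∧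
    (∀ n : ℤ, ∀ j : Fin (ψ (y n)).length, z (s n + (j : ℕ)) = (ψ (y n)).get j)

/-- `p(x,n) = Σ_{i<n} p(Sⁱ x)`. -/
def psum {X : Type} (p : X → ℕ) (S : X → X) (x : X) (n : ℕ) : ℕ :=
  ∑ i ∈ Finset.range n, p (S^[i] x)


/-- The substitution χ(a) = aab, χ(b) = abb on {a, b} = Fin 2 (a = 0, b = 1). -/
def chi : Fin 2 → List (Fin 2) := fun i => if i = 0 then [0, 0, 1] else [0, 1, 1]


namespace ChiSpeedup

/-- The `m`-th letter of `χ^k(a)`. -/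
def W : ℕ → Fin 2 → ℕ → Fin 2
  | 0, a, _ => a
  | k + 1, a, m => if m % 3 = 0 then 0 else if m % 3 = 2 then 1 else W k a (m / 3)

theorem substPow_succ' (k : ℕ) (a : Fin 2) :
    substPow chi (k + 1) a = (substPow chi k a).flatMap chi := by
  induction k generalizing a with
  | zero => simp [substPow]
  | succ k ih =>
    rw [substPow]
    conv_lhs => rw [List.flatMap_congr (fun b _ => ih b)]
    rw [← List.flatMap_assoc]
    rfl

theorem flatMap_chi_range (f : ℕ → Fin 2) (n : ℕ) :
    ((List.range n).map f).flatMap chi = (List.range (3 * n)).map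
      (fun m => if m % 3 = 0 then 0 else if m % 3 = 2 then 1 else f (m / 3)) := by
  induction n with
  | zero => simp
  | succ n ih =>
    have h3 : 3 * (n + 1) = 3 * n + 1 + 1 + 1 := by ring
    rw [h3, List.range_succ, List.map_append, List.flatMap_append, ih, List.range_succ,
      List.range_succ, List.range_succ]
    have e1 : (3 * n + 1) % 3 = 1 := by omega
    have e2 : (3 * n + 1 + 1) % 3 = 2 := by omega
    have e3 : (3 * n + 1) / 3 = n := by omega
    simp only [List.map_append, List.append_assoc, List.map_cons, List.map_nil,
      List.flatMap_cons, List.flatMap_nil, e1, e2, e3]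
    have : f n = 0 ∨ f n = 1 := by
      generalize f n = t
      fin_cases t <;> simp
    rcases this with h | h <;> simp [h, chi]

theorem substPow_eq (k : ℕ) (a : Fin 2) :
    substPow chi k a = (List.range (3 ^ k)).map (W k a) := by
  induction k with
  | zero => simp [substPow, W]
  | succ k ih =>
    rw [substPow_succ', ih, flatMap_chi_range, pow_succ, mul_comm]
    rfl

theorem mem_iff (x : ℤ → Fin 2) : x ∈ substShift chi ↔
    ∀ (i : ℤ) (n : ℕ), ∃ (k : ℕ) (a : Fin 2) (off : ℕ), off + n ≤ 3 ^ k ∧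
      ∀ m : ℕ, m < n → x (i + m) = W k a (off + m) := by
  unfold substShift
  simp only [Set.mem_ofPred_eq]
  refine forall_congr' fun i => forall_congr' fun n => exists_congr fun k =>
    exists_congr fun a => ?_
  rw [substPow_eq, List.infix_iff_getElem?]
  simp only [seqWord, List.length_ofFn, List.length_map, List.length_range, List.getElem_ofFn]
  refine exists_congr fun off => ?_
  constructor
  · rintro ⟨h1, h2⟩
    refine ⟨by omega, fun m hm => ?_⟩
    have := h2 m hm
    rw [List.getElem?_map, List.getElem?_range (by omega)] at this
    simp at this
    rw [← this, add_comm]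
  · rintro ⟨h1, h2⟩
    refine ⟨by omega, fun m hm => ?_⟩
    rw [List.getElem?_map, List.getElem?_range (by omega)]
    simp
    rw [h2 m hm, add_comm]

theorem fin2 (t : Fin 2) : t = 0 ∨ t = 1 := by fin_cases t <;> simp

theorem shiftZ_mem {x : ℤ → Fin 2} (hx : x ∈ substShift chi) (n : ℤ) :
    shiftZ n x ∈ substShift chi := by
  rw [mem_iff] at hx ⊢
  intro i l
  obtain ⟨k, a, off, h1, h2⟩ := hx (i + n) l
  refine ⟨k, a, off, h1, fun m hm => ?_⟩
  rw [← h2 m hm]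
  simp only [shiftZ]
  congr 1; ring

/-- The substitution acting on sequences. -/
def Th (x : ℤ → Fin 2) : ℤ → Fin 2 := fun t =>
  if t % 3 = 0 then 0 else if t % 3 = 2 then 1 else x (t / 3)

theorem Th_mem {x : ℤ → Fin 2} (hx : x ∈ substShift chi) : Th x ∈ substShift chi := by
  rw [mem_iff] at hx ⊢
  intro i l
  obtain ⟨k, a, off, h1, h2⟩ := hx (i / 3) (l + 1)
  refine ⟨k + 1, a, 3 * off + (i % 3).toNat, by rw [pow_succ]; omega, fun m hm => ?_⟩
  have hq := h2 (((i + m) / 3 - i / 3).toNat) (by omega)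
  have c1 : (3 * off + (i % 3).toNat + m) % 3 = ((i + m) % 3).toNat := by omega
  have c2 : (3 * off + (i % 3).toNat + m) / 3 = off + ((i + m) / 3 - i / 3).toNat := by omega
  simp only [Th, W]
  rw [c1, c2, ← hq]
  have c3 : i / 3 + (((i + m) / 3 - i / 3).toNat : ℤ) = (i + m) / 3 := by omega
  rw [c3]
  have : (i + m) % 3 = 0 ∨ (i + m) % 3 = 1 ∨ (i + m) % 3 = 2 := by omega
  rcases this with h | h | h <;> simp [h]

/-- the marker of a block boundary at `0`. -/
def Mk (x : ℤ → Fin 2) : Prop := x (-1) = 1 ∧ x 0 = 0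

theorem Mk_Th (x : ℤ → Fin 2) (t : ℤ) : Mk (shiftZ t (Th x)) ↔ t % 3 = 0 := by
  have : t % 3 = 0 ∨ t % 3 = 1 ∨ t % 3 = 2 := by omega
  unfold Mk shiftZ Th
  rcases this with h | h | h
  · have e : (-1 + t) % 3 = 2 := by omega
    simp [h, e]
  · have e : (-1 + t) % 3 = 0 := by omega
    simp [h, e]
  · simp [h]

theorem exists_align {x : ℤ → Fin 2} (hx : x ∈ substShift chi) (i : ℤ) (n : ℕ) (hn : 2 ≤ n) :
    ∃ (r : ℤ) (k : ℕ) (a : Fin 2) (off : ℕ), 0 ≤ r ∧ r < 3 ∧ off + n ≤ 3 ^ (k + 1) ∧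
      (i - r - off) % 3 = 0 ∧
      ∀ m : ℕ, m < n → x (i + m) = W (k + 1) a (off + m) := by
  obtain ⟨k, a, off, h1, h2⟩ := (mem_iff x).1 hx i n
  rcases k with _ | k
  · simp at h1; omega
  · exact ⟨(i - off) % 3, k, a, off, by omega, by omega, h1, by omega, h2⟩

theorem exists_res {x : ℤ → Fin 2} (hx : x ∈ substShift chi) :
    ∃ r : ℤ, 0 ≤ r ∧ r < 3 ∧ ∀ t : ℤ, ((t - r) % 3 = 0 → x t = 0) ∧
      ((t - r) % 3 = 2 → x t = 1) := by
  obtain ⟨r, k, a, off, hr0, hr3, h1, h2, h3⟩ := exists_align hx 0 3 (by norm_num)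
  refine ⟨r, hr0, hr3, fun t => ?_⟩
  obtain ⟨r', k', a', off', hr0', hr3', h1', h2', h3'⟩ :=
    exists_align hx (-(t.natAbs : ℤ)) (2 * t.natAbs + 4) (by omega)
  have key : ∀ s : ℤ, -(t.natAbs : ℤ) ≤ s → s < (t.natAbs : ℤ) + 4 → ((s - r') % 3 = 0 → x s = 0) ∧
      ((s - r') % 3 = 2 → x s = 1) := by
    intro s hs1 hs2
    have := h3' (s + (t.natAbs : ℤ)).toNat (by omega)
    have e : -(t.natAbs : ℤ) + ((s + (t.natAbs : ℤ)).toNat : ℤ) = s := by omega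
    rw [e] at this
    rw [this]
    simp only [W]
    constructor
    · intro h
      rw [if_pos (by omega)]
    · intro h
      rw [if_neg (by omega), if_pos (by omega)]
  have key0 : ∀ s : ℤ, 0 ≤ s → s < 3 → ((s - r) % 3 = 0 → x s = 0) ∧
      ((s - r) % 3 = 2 → x s = 1) := by
    intro s hs1 hs2
    have := h3 s.toNat (by omega)
    have e : 0 + (s.toNat : ℤ) = s := by omega
    rw [e] at this
    rw [this]
    simp only [W]
    constructor
    · intro h
      rw [if_pos (by omega)]
    · intro h
      rw [if_neg (by omega), if_pos (by omega)]
  have hrr : r = r' := by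
    by_contra hne
    have : (r - r') % 3 = 1 ∨ (r - r') % 3 = 2 := by omega
    rcases this with h | h
    · -- position (r+2) % 3
      have a1 := (key0 ((r + 2) % 3) (by omega) (by omega)).2 (by omega)
      have a2 := (key ((r + 2) % 3) (by omega) (by omega)).1 (by omega)
      rw [a1] at a2; exact absurd a2 (by decide)
    · have a1 := (key0 r (by omega) (by omega)).1 (by omega)
      have a2 := (key r (by omega) (by omega)).2 (by omega)
      rw [a1] at a2; exact absurd a2 (by decide)
  subst hrr
  exact key t (by omega) (by omega)

theorem exists_decode {x : ℤ → Fin 2} (hx : x ∈ substShift chi) :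
    ∃ r : ℤ, 0 ≤ r ∧ r < 3 ∧ ∃ y ∈ substShift chi, x = shiftZ r (Th y) := by
  obtain ⟨r, hr0, hr3, h⟩ := exists_res hx
  refine ⟨(-r) % 3, by omega, by omega, fun k => x (3 * k + 1 - (-r) % 3), ?_, ?_⟩
  · rw [mem_iff]
    intro i n
    obtain ⟨r', k', a', off', hr0', hr3', h1', h2', h3'⟩ :=
      exists_align hx (3 * i - (-r) % 3) (3 * n + 3) (by omega)
    have hrr : (r - r') % 3 = 0 := by
      by_contra hne
      have hs : (3 * i - (-r) % 3 - r) % 3 = 0 := by omega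
      have b0 := h3' 0 (by omega)
      have b2 := h3' 2 (by omega)
      rw [(h _).1 (by push_cast; omega)] at b0
      rw [(h _).2 (by push_cast; omega)] at b2
      have : off' % 3 = 1 ∨ off' % 3 = 2 := by omega
      simp only [W] at b0 b2
      rcases this with h | h
      · rw [if_pos (by omega)] at b2; exact absurd b2 (by decide)
      · rw [if_neg (by omega), if_pos (by omega)] at b0; exact absurd b0 (by decide)
    refine ⟨k', a', off' / 3, by rw [pow_succ] at h1'; omega, fun m hm => ?_⟩
    have := h3' (3 * m + 1) (by omega)
    have e : 3 * i - (-r) % 3 + ((3 * m + 1 : ℕ) : ℤ) = 3 * (i + m) + 1 - (-r) % 3 := by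
      push_cast; ring
    rw [e] at this
    rw [this]
    simp only [W]
    rw [if_neg (by omega), if_neg (by omega)]
    congr 1; omega
  · funext t
    simp only [shiftZ, Th]
    split_ifs with c1 c2
    · exact (h t).1 (by omega)
    · exact (h t).2 (by omega)
    · congr 1; omega

theorem aperiodic_aux (n : ℕ) : ∀ (k : ℤ), k.natAbs ≤ n → ∀ x ∈ substShift chi,
    shiftZ k x = x → k = 0 := by
  induction n with
  | zero => intro k hk _ _ _; omega
  | succ n ih =>
    intro k hk x hx hkx
    by_contra hk0
    obtain ⟨r, _, _, y, hy, rfl⟩ := exists_decode hx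
    have h1 : shiftZ k (Th y) = Th y := by
      funext t
      have := congrFun hkx (t - r)
      simp only [shiftZ] at this ⊢
      rw [show t - r + k + r = t + k by ring, show t - r + r = t by ring] at this
      exact this
    have h2 : k % 3 = 0 := by
      rw [← Mk_Th y, h1]
      have := (Mk_Th y 0).2 rfl
      have e : shiftZ 0 (Th y) = Th y := by
        funext t; simp [shiftZ]
      rwa [e] at this
    have h3 : k / 3 = 0 := by
      apply ih (k / 3) (by omega) y hy
      funext t
      have := congrFun h1 (3 * t + 1)
      simp only [shiftZ, Th] at this ⊢
      rw [if_neg (by omega), if_neg (by omega), if_neg (by omega), if_neg (by omega)] at this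
      rw [show (3 * t + 1 + k) / 3 = t + k / 3 by omega, show (3 * t + 1) / 3 = t by omega] at this
      exact this
    omega

theorem isClosed_X : IsClosed (substShift chi) := by
  have : substShift chi = ⋂ (i : ℤ), ⋂ (n : ℕ),
      (fun x : ℤ → Fin 2 => fun m : Fin n => x (i + (m : ℕ))) ⁻¹'
        {w | ∃ (k : ℕ) (a : Fin 2), (List.ofFn w).IsInfix (substPow chi k a)} := by
    ext x
    simp [substShift, seqWord]
  rw [this]
  refine isClosed_iInter fun i => isClosed_iInter fun n => ?_
  exact (isClosed_discrete _).preimage (by fun_prop)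

end ChiSpeedup

namespace ChiSpeedup

/-- the substitution subshift as a type. -/
abbrev XX := ↥(substShift chi)

/-- the shift by `n` on `XX`. -/
def sh (n : ℤ) (x : XX) : XX := ⟨shiftZ n x.1, shiftZ_mem x.2 n⟩

theorem sh_apply (n : ℤ) (x : XX) (k : ℤ) : (sh n x).1 k = x.1 (k + n) := rfl

theorem sh_sh (m n : ℤ) (x : XX) : sh m (sh n x) = sh (m + n) x := by
  apply Subtype.ext
  funext k
  simp only [sh_apply]
  rw [add_assoc]

theorem sh_zero (x : XX) : sh 0 x = x := by
  apply Subtype.ext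
  funext k
  simp [sh_apply]

theorem sh_cont (n : ℤ) : Continuous (sh n) := by
  unfold sh
  refine Continuous.subtype_mk ?_ _
  unfold shiftZ
  exact continuous_pi fun m => (continuous_apply (m + n)).comp continuous_subtype_val

theorem sh_aper {k : ℤ} {x : XX} (h : sh k x = x) : k = 0 :=
  aperiodic_aux k.natAbs k le_rfl x.1 x.2 (congrArg Subtype.val h)

theorem sh_inj {m n : ℤ} {x : XX} (h : sh m x = sh n x) : m = n := by
  have : sh (m - n) (sh n x) = sh n x := by
    rw [sh_sh, sub_add_cancel, h]
  have := sh_aper this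
  omega

theorem sh_cancel {m : ℤ} {x y : XX} (h : sh m x = y) : x = sh (-m) y := by
  rw [← h, sh_sh, neg_add_cancel, sh_zero]

instance : CompactSpace XX := isCompact_iff_compactSpace.1 isClosed_X.isCompact

/-- the substitution on `XX`. -/
def TH (x : XX) : XX := ⟨Th x.1, Th_mem x.2⟩

theorem TH_apply (x : XX) (t : ℤ) : (TH x).1 t =
    if t % 3 = 0 then 0 else if t % 3 = 2 then 1 else x.1 (t / 3) := rfl

theorem sh_TH (y : XX) : sh 3 (TH y) = TH (sh 1 y) := by
  apply Subtype.ext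
  funext k
  simp only [sh_apply, TH_apply]
  have e1 : (k + 3) % 3 = k % 3 := by omega
  have e2 : (k + 3) / 3 = k / 3 + 1 := by omega
  rw [e1, e2]

theorem decode (x : XX) : ∃ r : ℤ, 0 ≤ r ∧ r < 3 ∧ ∃ y : XX, x = sh r (TH y) := by
  obtain ⟨r, h0, h3, y, hy, h⟩ := exists_decode x.2
  exact ⟨r, h0, h3, ⟨y, hy⟩, Subtype.ext h⟩

theorem decode_unique {r r' : ℤ} (h0 : 0 ≤ r) (h3 : r < 3) (h0' : 0 ≤ r') (h3' : r' < 3)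
    {x x' y y' : XX} (hx : x = sh r (TH y)) (hx' : x' = sh r' (TH y'))
    (h : ∀ k : ℤ, -4 ≤ k → k < 4 → x.1 k = x'.1 k) : r = r' := by
  have hm : ∀ t : ℤ, -3 ≤ t → t < 4 → ((t + r) % 3 = 0 ↔ (t + r') % 3 = 0) := by
    intro t ht1 ht2
    rw [← Mk_Th y.1, ← Mk_Th y'.1]
    have e : ∀ k : ℤ, x.1 k = Th y.1 (k + r) := fun k => by rw [hx]; rfl
    have e' : ∀ k : ℤ, x'.1 k = Th y'.1 (k + r') := fun k => by rw [hx']; rfl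
    have g : ∀ k : ℤ, -4 ≤ k → k < 4 → Th y.1 (k + r) = Th y'.1 (k + r') := by
      intro k h1 h2
      rw [← e, ← e', h k h1 h2]
    have g1 := g (t - 1) (by omega) (by omega)
    have g2 := g t (by omega) (by omega)
    simp only [Mk, shiftZ]
    rw [show -1 + (t + r) = t - 1 + r by ring, show -1 + (t + r') = t - 1 + r' by ring, g1,
      zero_add, zero_add, g2]
  have := hm (-r) (by omega) (by omega)
  omega

/-- `F x` depends only on the coordinates in `[-u, v)`. -/
def Win {V : Type*} (u v : ℕ) (F : XX → V) : Prop :=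
  ∀ x y : XX, (∀ k : ℤ, -(u : ℤ) ≤ k → k < v → x.1 k = y.1 k) → F x = F y

theorem Win.mono {V : Type*} {u v u' v' : ℕ} {F : XX → V} (h : Win u v F) (hu : u ≤ u')
    (hv : v ≤ v') : Win u' v' F :=
  fun x y hxy => h x y fun k h1 h2 => hxy k (by omega) (by omega)

theorem isOpen_cyl (x : XX) (u v : ℕ) :
    IsOpen {y : XX | ∀ k : ℤ, -(u : ℤ) ≤ k → k < v → x.1 k = y.1 k} := by
  have : {y : XX | ∀ k : ℤ, -(u : ℤ) ≤ k → k < v → x.1 k = y.1 k} =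
      ⋂ k ∈ Set.Ico (-(u : ℤ)) v, (fun y : XX => y.1 k) ⁻¹' {x.1 k} := by
    ext y
    simp only [Set.mem_ofPred_eq, Set.mem_iInter, Set.mem_preimage, Set.mem_singleton_iff,
      Set.mem_Ico]
    exact ⟨fun h k hk => (h k hk.1 hk.2).symm, fun h k h1 h2 => (h k ⟨h1, h2⟩).symm⟩
  rw [this]
  refine (Set.finite_Ico _ _).isOpen_biInter fun k _ => ?_
  exact (isOpen_discrete _).preimage ((continuous_apply k).comp continuous_subtype_val)

theorem Win.lc {V : Type*} {u v : ℕ} {F : XX → V} (h : Win u v F) : IsLocallyConstant F := by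
  rw [IsLocallyConstant.iff_exists_open]
  intro x
  exact ⟨_, isOpen_cyl x u v, fun k _ _ => rfl, fun y hy => (h x y hy).symm⟩

theorem exists_cyl {O : Set XX} (hO : IsOpen O) {x : XX} (hx : x ∈ O) :
    ∃ w : ℕ, ∀ y : XX, (∀ k : ℤ, -(w : ℤ) ≤ k → k < w → x.1 k = y.1 k) → y ∈ O := by
  obtain ⟨O', hO', rfl⟩ := isOpen_induced_iff.1 hO
  obtain ⟨I, u, hu, hsub⟩ := isOpen_pi_iff.1 hO' x.1 hx
  refine ⟨I.sup Int.natAbs + 1, fun y hy => hsub ?_⟩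
  intro i hi
  have hle : Int.natAbs i ≤ I.sup Int.natAbs := Finset.le_sup (f := Int.natAbs) hi
  rw [← hy i (by push_cast; omega) (by push_cast; omega)]
  exact (hu i hi).2

theorem exists_win {V : Type*} {F : XX → V} (h : IsLocallyConstant F) : ∃ w, Win w w F := by
  have h1 : ∀ x : XX, ∃ w : ℕ, ∀ y : XX,
      (∀ k : ℤ, -(w : ℤ) ≤ k → k < w → x.1 k = y.1 k) → F y = F x := by
    intro x
    obtain ⟨w, hw⟩ := exists_cyl (h.isOpen_fiber (F x)) (x := x) rfl
    exact ⟨w, hw⟩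
  choose w hw using h1
  obtain ⟨t, ht⟩ := isCompact_univ.elim_finite_subcover
    (fun x : XX => {y : XX | ∀ k : ℤ, -(w x : ℤ) ≤ k → k < w x → x.1 k = y.1 k})
    (fun x => isOpen_cyl x _ _) (fun x _ => Set.mem_iUnion.2 ⟨x, fun _ _ _ => rfl⟩)
  refine ⟨t.sup w, fun x y hxy => ?_⟩
  obtain ⟨c, hc⟩ := Set.mem_iUnion.1 (ht (Set.mem_univ x))
  obtain ⟨hct, hcx⟩ := Set.mem_iUnion.1 hc
  have hle : w c ≤ t.sup w := Finset.le_sup hct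
  rw [hw c x hcx, hw c y]
  intro k h1 h2
  rw [hcx k h1 h2]
  exact hxy k (by omega) (by omega)

/-- An affine map `r ↦ e r + c`. -/
structure Aff where
  e : ℤ
  c : ℤ

/-- composition. -/
def Aff.comp (g h : Aff) : Aff := ⟨g.e * h.e, g.e * h.c + g.c⟩

/-- action with scaling `t` of the translation part. -/
def Aff.act {R : Type*} [CommRing R] (t : R) (g : Aff) (r : R) : R := (g.e : R) * r + t * (g.c : R)

theorem Aff.act_comp {R : Type*} [CommRing R] (t : R) (g h : Aff) (r : R) :
    (g.comp h).act t r = g.act t (h.act t r) := by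
  simp only [Aff.act, Aff.comp]
  push_cast
  ring

/-- renormalization of a cocycle. -/
def ren (M : XX → Aff) (y : XX) : Aff :=
  (M (sh 2 (TH y))).comp ((M (sh 1 (TH y))).comp (M (TH y)))

theorem Win.ren {u v : ℕ} {M : XX → Aff} (h : Win u v M) :
    Win ((u + 1) / 3) (v / 3 + 1) (ren M) := by
  intro x y hxy
  have key : ∀ s : ℤ, 0 ≤ s → s ≤ 2 → M (sh s (TH x)) = M (sh s (TH y)) := by
    intro s h0 h2
    apply h
    intro k hk1 hk2
    simp only [sh_apply, TH_apply]
    split_ifs with c1 c2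
    · rfl
    · rfl
    · apply hxy <;> push_cast <;> omega
  have k0 := key 0 (by norm_num) (by norm_num)
  rw [sh_zero, sh_zero] at k0
  simp only [ChiSpeedup.ren]
  rw [key 2 (by norm_num) (by norm_num), key 1 (by norm_num) (by norm_num), k0]

theorem Win.comp_TH {V : Type*} {u v : ℕ} {F : XX → V} (h : Win u v F) :
    Win ((u + 1) / 3) ((v + 1) / 3) (F ∘ TH) := by
  intro x y hxy
  apply h
  intro k hk1 hk2
  simp only [TH_apply]
  split_ifs with c1 c2
  · rfl
  · rfl
  · apply hxy <;> push_cast <;> omega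

theorem win_ren_iter (n : ℕ) : ∀ (u v : ℕ) (M : XX → Aff), 1 ≤ v → u + v ≤ n + 1 → Win u v M →
    Win 0 1 (ren^[n] M) := by
  induction n with
  | zero =>
    intro u v M hv huv h
    have : u = 0 := by omega
    have : v = 1 := by omega
    subst_vars
    exact h
  | succ n ih =>
    intro u v M hv huv h
    rw [Function.iterate_succ_apply]
    exact ih _ _ (ren M) (by omega) (by omega) h.ren

theorem win_TH_iter {V : Type*} (n : ℕ) : ∀ (u v : ℕ) (F : XX → V), u + v ≤ n → Win u v F →
    Win 0 0 (F ∘ TH^[n]) := by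
  induction n with
  | zero =>
    intro u v M huv h
    have : u = 0 := by omega
    have : v = 0 := by omega
    subst_vars
    exact h
  | succ n ih =>
    intro u v F huv h
    rw [Function.iterate_succ', ← Function.comp_assoc]
    exact ih _ _ (F ∘ TH) (by omega) h.comp_TH

theorem equivar_TH {R : Type*} [CommRing R] (t : R) (F : XX → R) (M : XX → Aff)
    (h : ∀ x, F (sh 1 x) = (M x).act t (F x)) (y : XX) :
    (F ∘ TH) (sh 1 y) = (ren M y).act t ((F ∘ TH) y) := by
  simp only [Function.comp, ren, Aff.act_comp]
  rw [← h, ← h, sh_sh, show (1 : ℤ) + 1 = 2 by norm_num, ← h, sh_sh, ← sh_TH,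
    show (1 : ℤ) + 2 = 3 by norm_num]

theorem equivar_iter {R : Type*} [CommRing R] (t : R) (n : ℕ) : ∀ (F : XX → R) (M : XX → Aff),
    (∀ x, F (sh 1 x) = (M x).act t (F x)) → ∀ y,
    (F ∘ TH^[n]) (sh 1 y) = (ren^[n] M y).act t ((F ∘ TH^[n]) y) := by
  induction n with
  | zero => intro F M h y; exact h y
  | succ n ih =>
    intro F M h y
    rw [Function.iterate_succ', ← Function.comp_assoc, Function.iterate_succ_apply]
    exact ih (F ∘ TH) (ren M) (equivar_TH t F M h) y

theorem descend_one {R : Type*} [CommRing R] (t : R) (M : XX → Aff) (D' : XX → R) {w : ℕ}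
    (hM : Win w w M) (hD : Win w w D') (h : ∀ y, D' (sh 1 y) = (ren M y).act t (D' y)) :
    ∃ D : XX → R, (∃ w', Win w' w' D) ∧ (∀ x, D (sh 1 x) = (M x).act t (D x)) ∧
      ∀ y, D (TH y) = D' y := by
  choose r hr0 hr3 b hb using decode
  have uniq : ∀ (s : ℤ) (y : XX), 0 ≤ s → s < 3 → r (sh s (TH y)) = s ∧ b (sh s (TH y)) = y := by
    intro s y h0 h3
    have h1 : r (sh s (TH y)) = s :=
      decode_unique (hr0 _) (hr3 _) h0 h3 (hb (sh s (TH y))) rfl (fun _ _ _ => rfl)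
    refine ⟨h1, ?_⟩
    have h2 := hb (sh s (TH y))
    rw [h1] at h2
    apply Subtype.ext
    funext k
    have h3 := congrArg (fun z : XX => z.1 (3 * k + 1 - s)) h2
    simp only [sh_apply, TH_apply] at h3
    rw [if_neg (by omega), if_neg (by omega), if_neg (by omega), if_neg (by omega),
      show (3 * k + 1 - s + s) / 3 = k by omega] at h3
    exact h3.symm
  let D : XX → R := fun x => if r x = 0 then D' (b x) else if r x = 1 then
    (M (TH (b x))).act t (D' (b x)) else
    (M (sh 1 (TH (b x)))).act t ((M (TH (b x))).act t (D' (b x)))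
  have D0 : ∀ y, D (TH y) = D' y := by
    intro y
    have := uniq 0 y le_rfl (by norm_num)
    rw [sh_zero] at this
    simp [D, this]
  have D1 : ∀ y, D (sh 1 (TH y)) = (M (TH y)).act t (D' y) := by
    intro y
    have := uniq 1 y (by norm_num) (by norm_num)
    simp [D, this]
  have D2 : ∀ y, D (sh 2 (TH y)) = (M (sh 1 (TH y))).act t ((M (TH y)).act t (D' y)) := by
    intro y
    have := uniq 2 y (by norm_num) (by norm_num)
    simp [D, this]
  refine ⟨D, ⟨3 * w + 10, ?_⟩, ?_, D0⟩
  · intro x x' hxx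
    have hr : r x = r x' := decode_unique (hr0 x) (hr3 x) (hr0 x') (hr3 x') (hb x) (hb x')
      (fun k h1 h2 => hxx k (by push_cast; omega) (by push_cast; omega))
    have hy : ∀ k : ℤ, -(w : ℤ) ≤ k → k < w → (b x).1 k = (b x').1 k := by
      intro k h1 h2
      have e : ∀ z : XX, (b z).1 k = z.1 (3 * k + 1 - r z) := by
        intro z
        have h3 := congrArg (fun z' : XX => z'.1 (3 * k + 1 - r z)) (hb z)
        simp only [sh_apply, TH_apply] at h3
        rw [if_neg (by omega), if_neg (by omega),
          show (3 * k + 1 - r z + r z) / 3 = k by omega] at h3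
        exact h3.symm
      have a0 := hr0 x
      have a3 := hr3 x
      rw [e x, e x', ← hr]
      exact hxx _ (by push_cast; omega) (by push_cast; omega)
    have hs : ∀ s : ℤ, 0 ≤ s → s ≤ 1 → M (sh s (TH (b x))) = M (sh s (TH (b x'))) := by
      intro s h0 h1
      have e : ∀ z : XX, sh s (TH (b z)) = sh (s - r z) z := by
        intro z
        conv_rhs => rw [hb z]
        rw [sh_sh, ← hb z, sub_add_cancel]
      have a0 := hr0 x
      have a3 := hr3 x
      rw [e, e, ← hr]
      apply hM
      intro k h1 h2
      rw [sh_apply, sh_apply]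
      exact hxx _ (by push_cast; omega) (by push_cast; omega)
    have q0 := hs 0 le_rfl (by norm_num)
    have q1 := hs 1 (by norm_num) (by norm_num)
    rw [sh_zero, sh_zero] at q0
    have q2 := hD _ _ hy
    simp only [D, hr, q0, q1, q2]
  · intro x
    have a0 := hr0 x
    have a3 := hr3 x
    have hx := hb x
    have : r x = 0 ∨ r x = 1 ∨ r x = 2 := by omega
    generalize b x = y at hx
    rcases this with h0 | h0 | h0 <;> rw [h0] at hx <;> rw [hx]
    · rw [sh_zero, D0, D1]
    · rw [sh_sh, D1, show (1 : ℤ) + 1 = 2 by norm_num, D2]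
    · rw [sh_sh, D2, show (1 : ℤ) + 2 = 3 by norm_num, sh_TH, D0, h]
      simp only [ren, Aff.act_comp]

theorem descend {R : Type*} [CommRing R] (t : R) (n : ℕ) : ∀ (M : XX → Aff) (v : R),
    (∃ w, Win w w M) → (∀ y, (ren^[n] M y).act t v = v) →
    ∃ D : XX → R, (∃ w, Win w w D) ∧ (∀ x, D (sh 1 x) = (M x).act t (D x)) ∧
      ∀ y, D (TH^[n] y) = v := by
  induction n with
  | zero =>
    intro M v _ h
    exact ⟨fun _ => v, ⟨0, fun _ _ _ => rfl⟩, fun x => (h x).symm, fun _ => rfl⟩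
  | succ n ih =>
    rintro M v ⟨w, hw⟩ h
    obtain ⟨D', ⟨w', hw'⟩, hD', hv⟩ := ih (ren M) v
      ⟨max ((w + 1) / 3) (w / 3 + 1), hw.ren.mono (le_max_left _ _) (le_max_right _ _)⟩ h
    obtain ⟨D, hD1, hD2, hD3⟩ := descend_one t M D' (hw.mono (le_max_left w w') (le_max_left w w'))
      (hw'.mono (le_max_right w w') (le_max_right w w')) hD'
    refine ⟨D, hD1, hD2, fun y => ?_⟩
    rw [Function.iterate_succ_apply', hD3, hv]

end ChiSpeedup

namespace ChiSpeedup

/-- sign and parity constraint on the affine maps. -/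
def Aff.Good (g : Aff) : Prop := (g.e = 1 ∧ g.c % 2 = 1) ∨ (g.e = -1 ∧ g.c % 2 = 0)

theorem Aff.Good.comp3 {f g h : Aff} (hf : f.Good) (hg : g.Good) (hh : h.Good) :
    (f.comp (g.comp h)).Good := by
  rcases f with ⟨e1, c1⟩
  rcases g with ⟨e2, c2⟩
  rcases h with ⟨e3, c3⟩
  simp only [Good, Aff.comp] at *
  rcases hf with ⟨rfl, h1⟩ | ⟨rfl, h1⟩ <;> rcases hg with ⟨rfl, h2⟩ | ⟨rfl, h2⟩ <;>
    rcases hh with ⟨rfl, h3⟩ | ⟨rfl, h3⟩ <;> norm_num <;> omega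

theorem good_ren (n : ℕ) : ∀ M : XX → Aff, (∀ x, (M x).Good) → ∀ x, (ren^[n] M x).Good := by
  induction n with
  | zero => intro M h; exact h
  | succ n ih =>
    intro M h x
    rw [Function.iterate_succ_apply]
    exact ih (ren M) (fun y => (h _).comp3 (h _) (h _)) x

theorem zmod_zero {q : ℕ} {m : ℤ} (h : ((m : ℤ) : ZMod q) = 0) (hq : m.natAbs < q) : m = 0 := by
  rw [ZMod.intCast_zmod_eq_zero_iff_dvd] at h
  exact Int.eq_zero_of_dvd_of_natAbs_lt_natAbs h (by simpa using hq)

theorem main_alg (y0 : XX) (M : XX → Aff) (hM : ∃ w, Win w w M) (hgood : ∀ x, (M x).Good)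
    (Hq : ∀ N : ℕ, ∃ q > N, ∃ F : XX → ZMod q, (∃ w, Win w w F) ∧
      ∀ x, F (sh 1 x) = (M x).act 2 (F x)) :
    (∃ s : XX → ℤ, (∃ w, Win w w s) ∧ (∃ x, s x = 1) ∧ ∀ x, s (sh 1 x) = (M x).e * s x) ∨
    (∃ D : XX → ℤ, (∃ w, Win w w D) ∧ ∀ x, D (sh 1 x) = (M x).e * D x + (M x).c) := by
  have hM' := hM
  obtain ⟨w, hw⟩ := hM
  have hwin : ∀ n, 2 * w + 1 ≤ n → Win 0 1 (ren^[n] M) := fun n hn =>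
    win_ren_iter n w (w + 1) M (by omega) (by omega) (hw.mono le_rfl (by omega))
  set n0 := 2 * w + 1 with hn0
  set ya : XX := TH y0 with hya
  set yb : XX := sh 2 (TH y0) with hyb
  have ha : ya.1 0 = 0 := by simp [hya, TH_apply]
  have hb : yb.1 0 = 1 := by simp [hyb, TH_apply, sh_apply]
  let A : ℕ → Aff := fun n => ren^[n] M ya
  let B : ℕ → Aff := fun n => ren^[n] M yb
  have hval : ∀ n, n0 ≤ n → ∀ y z : XX, y.1 0 = z.1 0 → ren^[n] M y = ren^[n] M z := by
    intro n hn y z hyz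
    apply hwin n hn
    intro k h1 h2
    have : k = 0 := by push_cast at *; omega
    rw [this, hyz]
  have recA : ∀ n, n0 ≤ n → A (n + 1) = (B n).comp ((A n).comp (A n)) := by
    intro n hn
    simp only [A, B, Function.iterate_succ_apply']
    rw [ren, hval n hn (sh 2 (TH ya)) yb, hval n hn (sh 1 (TH ya)) ya, hval n hn (TH ya) ya]
    · simp [ha, TH_apply]
    · simp [TH_apply, sh_apply]
    · simp [hb, TH_apply, sh_apply]
  have recB : ∀ n, n0 ≤ n → B (n + 1) = (B n).comp ((B n).comp (A n)) := by
    intro n hn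
    simp only [A, B, Function.iterate_succ_apply']
    rw [ren, hval n hn (sh 2 (TH yb)) yb, hval n hn (sh 1 (TH yb)) yb, hval n hn (TH yb) ya]
    · simp [ha, TH_apply]
    · simp [TH_apply, sh_apply]
    · simp [hb, TH_apply, sh_apply]
  have gA : ∀ n, (A n).Good := fun n => good_ren n M hgood ya
  have gB : ∀ n, (B n).Good := fun n => good_ren n M hgood yb
  have fixpt : ∀ N : ℕ, ∃ q > N, ∃ n ≥ n0, ∃ f : ZMod q,
      (A n).act 2 f = f ∧ (B n).act 2 f = f := by
    intro N
    obtain ⟨q, hq, F, ⟨u, hu⟩, hF⟩ := Hq N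
    have h1 := win_TH_iter (n0 + 2 * u) u u F (by omega) hu
    have h2 := equivar_iter 2 (n0 + 2 * u) F M hF
    have h3 : ∀ y z, (F ∘ TH^[n0 + 2 * u]) y = (F ∘ TH^[n0 + 2 * u]) z := by
      intro y z
      apply h1
      intro k h1 h2
      push_cast at *; omega
    refine ⟨q, hq, n0 + 2 * u, by omega, (F ∘ TH^[n0 + 2 * u]) y0, ?_, ?_⟩
    · have := h2 ya
      rw [h3 (sh 1 ya) y0, h3 ya y0] at this
      exact this.symm
    · have := h2 yb
      rw [h3 (sh 1 yb) y0, h3 yb y0] at this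
      exact this.symm
  -- general: mixed signs are impossible
  have mixed : ∀ c : ℤ, c % 2 = 1 →
      ((A n0).e = 1 ∧ (B n0).e = -1 ∧ (A n0).c = c) ∨
      ((A n0).e = -1 ∧ (B n0).e = 1 ∧ (B n0).c = c) → False := by
    intro c hc h0
    have hall : ∀ n, n0 ≤ n → ((A n).e = 1 ∧ (B n).e = -1 ∧ (A n).c = c) ∨
      ((A n).e = -1 ∧ (B n).e = 1 ∧ (B n).c = c) := by
      intro n hn
      induction n, hn using Nat.le_induction with
      | base => exact h0
      | succ n hn ih =>
        rw [recA n hn, recB n hn]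
        rcases ih with ⟨h1, h2, h3⟩ | ⟨h1, h2, h3⟩ <;> simp [Aff.comp, h1, h2, h3]
    obtain ⟨q, hq, n, hn, f, f1, f2⟩ := fixpt (2 * c).natAbs
    have hz : ((2 * c : ℤ) : ZMod q) = 0 := by
      rcases hall n hn with ⟨h1, h2, h3⟩ | ⟨h1, h2, h3⟩
      · rw [Aff.act, h1, h3] at f1
        push_cast at f1 ⊢
        linear_combination f1
      · rw [Aff.act, h2, h3] at f2
        push_cast at f2 ⊢
        linear_combination f2
    have := zmod_zero hz hq
    omega
  have hvals : ∀ y, ren^[n0] M y = A n0 ∨ ren^[n0] M y = B n0 := by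
    intro y
    rcases fin2 (y.1 0) with h | h
    · left; exact hval n0 le_rfl y ya (by rw [h, ha])
    · right; exact hval n0 le_rfl y yb (by rw [h, hb])
  rcases gA n0 with ⟨eA, cA⟩ | ⟨eA, cA⟩ <;> rcases gB n0 with ⟨eB, cB⟩ | ⟨eB, cB⟩
  · left
    obtain ⟨s, hs1, hs2, hs3⟩ := descend (0 : ℤ) n0 M 1 hM' (by
      intro y
      rcases hvals y with h | h <;> rw [h] <;> simp [Aff.act, eA, eB])
    refine ⟨s, hs1, ⟨_, hs3 y0⟩, fun x => ?_⟩
    rw [hs2]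
    simp [Aff.act]
  · exact (mixed _ cA (Or.inl ⟨eA, eB, rfl⟩)).elim
  · exact (mixed _ cB (Or.inr ⟨eA, eB, rfl⟩)).elim
  · right
    have hall : ∀ n, n0 ≤ n → (A n).e = -1 ∧ (B n).e = -1 ∧
        (((A n).c = (A n0).c ∧ (B n).c = (B n0).c) ∨
         ((A n).c = (B n0).c ∧ (B n).c = (A n0).c)) := by
      intro n hn
      induction n, hn using Nat.le_induction with
      | base => exact ⟨eA, eB, Or.inl ⟨rfl, rfl⟩⟩
      | succ n hn ih =>
        rw [recA n hn, recB n hn]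
        obtain ⟨h1, h2, h⟩ := ih
        rcases h with ⟨h3, h4⟩ | ⟨h3, h4⟩ <;> simp [Aff.comp, h1, h2, h3, h4]
    have hc : (A n0).c = (B n0).c := by
      obtain ⟨q, hq, n, hn, f, f1, f2⟩ := fixpt (2 * ((A n0).c - (B n0).c)).natAbs
      have hz : ((2 * ((A n0).c - (B n0).c) : ℤ) : ZMod q) = 0 := by
        obtain ⟨h1, h2, h⟩ := hall n hn
        rw [Aff.act, h1] at f1
        rw [Aff.act, h2] at f2
        rcases h with ⟨h3, h4⟩ | ⟨h3, h4⟩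
        · rw [h3] at f1
          rw [h4] at f2
          push_cast at f1 f2 ⊢
          linear_combination f1 - f2
        · rw [h3] at f1
          rw [h4] at f2
          push_cast at f1 f2 ⊢
          linear_combination f2 - f1
      have := zmod_zero hz hq
      omega
    obtain ⟨D, hD1, hD2, -⟩ := descend (1 : ℤ) n0 M ((A n0).c / 2) hM' (by
      intro y
      rcases hvals y with h | h <;> rw [h] <;> simp [Aff.act, eA, eB] <;> omega)
    refine ⟨D, hD1, fun x => ?_⟩
    rw [hD2]
    simp [Aff.act]

end ChiSpeedup

namespace ChiSpeedup

section Odo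
variable {X : Type} [TopologicalSpace X]

theorem zadd (S : X ≃ₜ X) (m n : ℤ) (x : X) : (S ^ m) ((S ^ n) x) = (S ^ (m + n)) x := by
  rw [zpow_add]; rfl

/-- closure of the orbit of `x0` under `S^m`. -/
def KK (S : X ≃ₜ X) (x0 : X) (m : ℕ) : Set X := closure (Set.range fun k : ℤ => (S ^ (k * (m : ℤ))) x0)

theorem KK_map (S : X ≃ₜ X) (x0 : X) (m : ℕ) (n : ℤ) (h : (S ^ n) x0 ∈ KK S x0 m)
    {y : X} (hy : y ∈ KK S x0 m) : (S ^ n) y ∈ KK S x0 m := by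
  have base : ∀ (k : ℤ) (z : X), z ∈ KK S x0 m → (S ^ (k * (m : ℤ))) z ∈ KK S x0 m := by
    intro k z hz
    refine map_mem_closure (S ^ (k * (m : ℤ))).continuous hz ?_
    rintro _ ⟨l, rfl⟩
    refine ⟨k + l, ?_⟩
    simp only [zadd]
    rw [add_mul]
  have hc : IsClosed {z : X | (S ^ n) z ∈ KK S x0 m} :=
    isClosed_closure.preimage (S ^ n).continuous
  have hsub : Set.range (fun k : ℤ => (S ^ (k * (m : ℤ))) x0) ⊆ {z : X | (S ^ n) z ∈ KK S x0 m} := by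
    rintro _ ⟨k, rfl⟩
    have := base k _ h
    rw [zadd, add_comm, ← zadd] at this
    exact this
  exact closure_minimal hsub hc hy

/-- the group of return times. -/
def HH (S : X ≃ₜ X) (x0 : X) (m : ℕ) (hm : 0 < m) : AddSubgroup ℤ where
  carrier := {n | (S ^ n) x0 ∈ KK S x0 m}
  add_mem' := by
    intro a b ha hb
    have := KK_map S x0 m a ha hb
    rw [zadd] at this
    exact this
  zero_mem' := by
    refine subset_closure ⟨0, ?_⟩
    simp
  neg_mem' := by
    intro a ha
    have h1 : ∀ n : ℕ, (S ^ ((n : ℤ) * a)) x0 ∈ KK S x0 m := by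
      intro n
      induction n with
      | zero => exact subset_closure ⟨0, by simp⟩
      | succ n ih =>
        have := KK_map S x0 m a ha ih
        rw [zadd] at this
        rw [show ((n + 1 : ℕ) : ℤ) * a = a + n * a by push_cast; ring]
        exact this
    have h2 : (S ^ (-a * (m : ℤ))) x0 ∈ KK S x0 m := subset_closure ⟨-a, rfl⟩
    have := KK_map S x0 m _ h2 (h1 (m - 1))
    rw [zadd] at this
    have e : -a * (m : ℤ) + ((m - 1 : ℕ) : ℤ) * a = -a := by
      rw [Nat.cast_sub (by omega)]; push_cast; ring
    rw [e] at this
    exact this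

theorem odometer_factor [T3Space X] (S : X ≃ₜ X) (x0 : X)
    (hrec : ∀ O ∈ 𝓝 x0, ∃ m : ℕ, 0 < m ∧ ∀ k : ℤ, (S ^ (k * (m : ℤ))) x0 ∈ O)
    (hdense : ∀ x, x ∈ closure (Set.range fun k : ℤ => (S ^ k) x0))
    (haper : ∀ n : ℤ, n ≠ 0 → (S ^ n) x0 ≠ x0) (N : ℕ) :
    ∃ q > N, ∃ U : X → ZMod q, IsLocallyConstant U ∧ ∀ x, U (S x) = U x + 1 := by
  -- choose the period
  have hne : (S ^ ((N.factorial : ℕ) : ℤ)) x0 ≠ x0 :=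
    haper _ (by exact_mod_cast N.factorial_ne_zero)
  obtain ⟨C, hC, hCc, hCs⟩ := exists_mem_nhds_isClosed_subset
    (isOpen_compl_singleton.mem_nhds (show x0 ∈ ({(S ^ ((N.factorial : ℕ) : ℤ)) x0}ᶜ : Set X) from
      fun h => hne h.symm))
  obtain ⟨m, hm, hmC⟩ := hrec C hC
  have hKC : KK S x0 m ⊆ C := closure_minimal (by rintro _ ⟨k, rfl⟩; exact hmC k) hCc
  have hNot : ((N.factorial : ℕ) : ℤ) ∉ HH S x0 m hm := fun h => hCs (hKC h) rfl
  obtain ⟨g, hg⟩ := Int.subgroup_cyclic (HH S x0 m hm)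
  have hH : ∀ n : ℤ, (S ^ n) x0 ∈ KK S x0 m ↔ ((g.natAbs : ℕ) : ℤ) ∣ n := by
    intro n
    change n ∈ HH S x0 m hm ↔ _
    rw [hg, ← AddSubgroup.zmultiples_eq_closure, Int.mem_zmultiples_iff, Int.natAbs_dvd]
  set q := g.natAbs with hq
  have hmH : (q : ℤ) ∣ m := (hH m).1 (subset_closure ⟨1, by simp⟩)
  have hq0 : 0 < q := by
    rcases Nat.eq_zero_or_pos q with h | h
    · rw [h] at hmH; simp at hmH; omega
    · exact h
  have hqN : N < q := by
    by_contra hle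
    apply hNot
    change (S ^ ((N.factorial : ℕ) : ℤ)) x0 ∈ KK S x0 m
    rw [hH]
    exact_mod_cast Nat.dvd_factorial hq0 (by omega)
  have hKcl : IsClosed (KK S x0 m) := isClosed_closure
  have P2 : ∀ x, ∃ n : ℤ, (S ^ (-n)) x ∈ KK S x0 m := by
    intro x
    have hcl : IsClosed (⋃ i ∈ Finset.range m, {x : X | (S ^ (-(i : ℤ))) x ∈ KK S x0 m}) :=
      isClosed_biUnion_finset fun i _ => hKcl.preimage (S ^ (-(i : ℤ))).continuous
    have hsub : Set.range (fun k : ℤ => (S ^ k) x0) ⊆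
        ⋃ i ∈ Finset.range m, {x : X | (S ^ (-(i : ℤ))) x ∈ KK S x0 m} := by
      rintro _ ⟨k, rfl⟩
      have h0 : 0 ≤ k % (m : ℤ) := Int.emod_nonneg _ (by omega)
      have h1 : k % (m : ℤ) < m := Int.emod_lt_of_pos _ (by omega)
      simp only [Set.mem_iUnion]
      refine ⟨(k % (m : ℤ)).toNat, Finset.mem_range.2 (by omega), ?_⟩
      refine subset_closure ⟨k / m, ?_⟩
      simp only
      rw [zadd, Int.toNat_of_nonneg h0]
      congr 2
      have := Int.emod_add_mul_ediv k m
      linarith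
    have := closure_minimal hsub hcl (hdense x)
    simp only [Set.mem_iUnion] at this
    obtain ⟨i, _, hi⟩ := this
    exact ⟨i, hi⟩
  have P3 : ∀ (y : X) (d : ℤ), y ∈ KK S x0 m → (S ^ d) y ∈ KK S x0 m → (q : ℤ) ∣ d := by
    intro y d hy hdy
    rw [← hH]
    have hcl : IsClosed {x : X | (S ^ d) x ∈ KK S x0 m} := hKcl.preimage (S ^ d).continuous
    change x0 ∈ {x : X | (S ^ d) x ∈ KK S x0 m}
    rw [← hcl.closure_eq, mem_closure_iff_nhds]
    intro O hO
    obtain ⟨C', hC', hCc', hCs'⟩ := exists_mem_nhds_isClosed_subset hO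
    obtain ⟨m', hm', hmC'⟩ := hrec C' hC'
    have hcl' : IsClosed (⋃ i ∈ Finset.range m', {x : X | (S ^ (-(i : ℤ) * m)) x ∈ C'}) :=
      isClosed_biUnion_finset fun i _ => hCc'.preimage (S ^ (-(i : ℤ) * m)).continuous
    have hsub : Set.range (fun k : ℤ => (S ^ (k * (m : ℤ))) x0) ⊆
        ⋃ i ∈ Finset.range m', {x : X | (S ^ (-(i : ℤ) * m)) x ∈ C'} := by
      rintro _ ⟨k, rfl⟩
      have h0 : 0 ≤ k % (m' : ℤ) := Int.emod_nonneg _ (by omega)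
      have h1 : k % (m' : ℤ) < m' := Int.emod_lt_of_pos _ (by omega)
      simp only [Set.mem_iUnion]
      refine ⟨(k % (m' : ℤ)).toNat, Finset.mem_range.2 (by omega), ?_⟩
      have := hmC' (k / m' * m)
      simp only [Set.mem_ofPred_eq]
      rw [zadd, Int.toNat_of_nonneg h0]
      have e : -(k % (m' : ℤ)) * m + k * m = k / m' * m * m' := by
        have := Int.emod_add_mul_ediv k m'
        linear_combination (-(m : ℤ)) * this
      rw [e]
      exact this
    have := closure_minimal hsub hcl' hy
    simp only [Set.mem_iUnion] at this
    obtain ⟨i, _, hi⟩ := this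
    refine ⟨(S ^ (-(i : ℤ) * m)) y, hCs' hi, ?_⟩
    change (S ^ d) ((S ^ (-(i : ℤ) * m)) y) ∈ KK S x0 m
    rw [zadd, add_comm, ← zadd]
    exact KK_map S x0 m _ (subset_closure ⟨-(i : ℤ), rfl⟩) hdy
  choose n hn using P2
  have key : ∀ (x : X) (k : ℤ), (S ^ (-k)) x ∈ KK S x0 m → ((n x : ℤ) : ZMod q) = k := by
    intro x k hk
    have h1 := P3 _ (n x - k) (hn x) (by
      rw [zadd, show n x - k + -n x = -k by ring]; exact hk)
    rw [← sub_eq_zero, ← Int.cast_sub, ZMod.intCast_zmod_eq_zero_iff_dvd]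
    exact h1
  refine ⟨q, hqN, fun x => ((n x : ℤ) : ZMod q), ?_, ?_⟩
  · have : NeZero q := ⟨hq0.ne'⟩
    have hfc : ∀ a : ZMod q, IsClosed {x | ((n x : ℤ) : ZMod q) = a} := by
      intro a
      have : {x | ((n x : ℤ) : ZMod q) = a} = {x | (S ^ (-(a.val : ℤ))) x ∈ KK S x0 m} := by
        ext x
        constructor
        · intro h
          simp only [Set.mem_ofPred_eq] at h
          have hd : (q : ℤ) ∣ n x - a.val := by
            rw [← ZMod.intCast_zmod_eq_zero_iff_dvd]
            push_cast
            rw [h, ZMod.natCast_zmod_val, sub_self]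
          have := KK_map S x0 m _ ((hH _).2 hd) (hn x)
          rw [zadd, show n x - a.val + -n x = -(a.val : ℤ) by ring] at this
          exact this
        · intro h
          have := key x _ h
          simp only [Set.mem_ofPred_eq]
          rw [this]
          push_cast
          rw [ZMod.natCast_zmod_val]
      rw [this]
      exact hKcl.preimage (S ^ (-(a.val : ℤ))).continuous
    rw [IsLocallyConstant.iff_isOpen_fiber]
    intro a
    rw [← isClosed_compl_iff]
    have : ((fun x => ((n x : ℤ) : ZMod q)) ⁻¹' {a})ᶜ =
        ⋃ b ∈ (Finset.univ.filter (fun b : ZMod q => b ≠ a)), {x | ((n x : ℤ) : ZMod q) = b} := by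
      ext x
      simp
    rw [this]
    exact isClosed_biUnion_finset fun b _ => hfc b
  · intro x
    have := key (S x) (n x + 1) (by
      have h1 : S x = (S ^ (1 : ℤ)) x := by simp
      rw [h1, zadd, show -(n x + 1) + 1 = -n x by ring]
      exact hn x)
    simp only [this]
    push_cast
    rfl

end Odo

end ChiSpeedup

namespace ChiSpeedup

/-- same orbit under `e`. -/
def SO (e : XX ≃ₜ XX) (x y : XX) : Prop := ∃ k : ℤ, (e ^ k) x = y

theorem SO.symm {e : XX ≃ₜ XX} {x y : XX} (h : SO e x y) : SO e y x := by
  obtain ⟨k, rfl⟩ := h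
  refine ⟨-k, ?_⟩
  rw [zadd]; simp

theorem SO.trans {e : XX ≃ₜ XX} {x y z : XX} (h : SO e x y) (h' : SO e y z) : SO e x z := by
  obtain ⟨k, rfl⟩ := h
  obtain ⟨l, rfl⟩ := h'
  exact ⟨l + k, by rw [zadd]⟩

theorem SO.refl (e : XX ≃ₜ XX) (x : XX) : SO e x x := ⟨0, by simp⟩

theorem zpow_one_app (e : XX ≃ₜ XX) (x : XX) : (e ^ (1 : ℤ)) x = e x := by simp

theorem zpow_neg_one_app (e : XX ≃ₜ XX) (x : XX) : (e ^ (-1 : ℤ)) x = e.symm x := by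
  rw [zpow_neg_one]; rfl

/-- basic speedup data. -/
structure Spd (e : XX ≃ₜ XX) (P : XX → ℕ) : Prop where
  pos : ∀ x, 1 ≤ P x
  eq : ∀ x, e x = sh (P x) x
  lc : IsLocallyConstant P

theorem Spd.nat {e : XX ≃ₜ XX} {P : XX → ℕ} (H : Spd e P) (n : ℕ) (x : XX) :
    ∃ i : ℤ, (n : ℤ) ≤ i ∧ (e ^ (n : ℤ)) x = sh i x := by
  induction n with
  | zero => exact ⟨0, le_rfl, by rw [sh_zero]; simp⟩
  | succ n ih =>
    obtain ⟨i, hi, h⟩ := ih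
    refine ⟨P (sh i x) + i, ?_, ?_⟩
    · have := H.pos (sh i x)
      push_cast; omega
    · push_cast
      rw [add_comm, ← zadd, h, zpow_one_app, H.eq, sh_sh]

theorem Spd.symm_eq {e : XX ≃ₜ XX} {P : XX → ℕ} (H : Spd e P) (y : XX) :
    e.symm y = sh (-(P (e.symm y) : ℤ)) y := by
  apply sh_cancel
  rw [← H.eq]; simp

theorem Spd.indep {e : XX ≃ₜ XX} {P : XX → ℕ} (H : Spd e P) (x : XX) {i j : ℕ} (hij : i < j)
    (hj : j < P (e.symm (sh j x))) : ¬ SO e (sh i x) (sh j x) := by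
  rintro ⟨k, hk⟩
  by_cases h1 : 1 ≤ k
  · obtain ⟨t, ht, h⟩ := H.nat (k - 1).toNat (sh i x)
    have e1 : (((k - 1).toNat : ℕ) : ℤ) = -1 + k := by omega
    rw [e1, ← zadd, hk, zpow_neg_one_app, H.symm_eq, sh_sh, sh_sh] at h
    have := sh_inj h
    omega
  · obtain ⟨t, ht, h⟩ := H.nat (-k).toNat (sh j x)
    have e1 : (((-k).toNat : ℕ) : ℤ) = -k := by omega
    rw [e1, ← hk, zadd, hk, sh_sh, neg_add_cancel] at h
    have h' : sh (i : ℤ) x = sh (t + j) x := by simpa using h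
    have := sh_inj h'
    omega

/-- orbit number two. -/
def Two (e : XX ≃ₜ XX) : Prop := ∀ x : XX, ∃ r : Fin 2 → XX, (∀ i, ∃ m : ℤ, r i = sh m x) ∧
  ¬ SO e (r 0) (r 1) ∧ ∀ m : ℤ, ∃ i, SO e (r i) (sh m x)

theorem Spd.ex {e : XX ≃ₜ XX} {P : XX → ℕ} (H : Spd e P) (h2 : Two e) (x : XX) :
    ∃ j : ℕ, 1 ≤ j ∧ j < P (e.symm (sh j x)) := by
  obtain ⟨r, hr, hn, -⟩ := h2 x
  have : ∃ i, ¬ SO e x (r i) := by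
    by_contra! hc
    exact hn ((hc 0).symm.trans (hc 1))
  obtain ⟨i, hi⟩ := this
  obtain ⟨m0, hm0⟩ := hr i
  have hex : ∃ m : ℕ, SO e (r i) (sh m x) := by
    obtain ⟨t, ht, h⟩ := H.nat m0.natAbs (r i)
    refine ⟨(t + m0).toNat, m0.natAbs, ?_⟩
    rw [h, hm0, sh_sh]
    congr 1; omega
  refine ⟨Nat.find hex, ?_, ?_⟩
  · by_contra hc
    have h0 : Nat.find hex = 0 := by omega
    have := Nat.find_spec hex
    rw [h0] at this
    rw [Nat.cast_zero, sh_zero] at this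
    exact hi this.symm
  · by_contra hc
    have hs := Nat.find_spec hex
    set m := Nat.find hex with hm
    have hp := H.pos (e.symm (sh m x))
    refine Nat.find_min hex (m := m - P (e.symm (sh m x))) (by omega) ?_
    refine hs.trans ⟨-1, ?_⟩
    refine ((zpow_neg_one_app _ _).trans (H.symm_eq _)).trans ?_
    rw [sh_sh]
    congr 1; omega

theorem Spd.uq {e : XX ≃ₜ XX} {P : XX → ℕ} (H : Spd e P) (h2 : Two e) (x : XX) {j k : ℕ}
    (hj : 1 ≤ j) (hjp : j < P (e.symm (sh j x))) (hk : 1 ≤ k) (hkp : k < P (e.symm (sh k x))) :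
    j = k := by
  have key : ∀ j k : ℕ, 1 ≤ j → j < P (e.symm (sh j x)) → k < P (e.symm (sh k x)) →
      j < k → False := by
    intro j k hj hjp hkp hlt
    obtain ⟨r, -, -, hc⟩ := h2 x
    obtain ⟨a, ha⟩ := hc (0 : ℕ)
    obtain ⟨b, hb⟩ := hc j
    obtain ⟨c, hc⟩ := hc k
    have h1 : a ≠ b := by
      rintro rfl; exact H.indep x (by omega : 0 < j) hjp (ha.symm.trans hb)
    have h2 : a ≠ c := by
      rintro rfl; exact H.indep x (by omega : 0 < k) hkp (ha.symm.trans hc)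
    have h3 : b ≠ c := by
      rintro rfl; exact H.indep x hlt hkp (hb.symm.trans hc)
    omega
  rcases lt_trichotomy j k with h | h | h
  · exact (key j k hj hjp hkp h).elim
  · exact h
  · exact (key k j hk hkp hjp h).elim

/-- the two-strand Markov structure. -/
structure Str (e : XX ≃ₜ XX) (P J : XX → ℕ) : Prop extends Spd e P where
  jlc : IsLocallyConstant J
  jpos : ∀ x, 1 ≤ J x
  one : ∀ x, P x = 1 → J x = J (sh 1 x) + 1
  two : ∀ x, P x ≠ 1 → J x = 1 ∧ J (sh 1 x) + 1 = P x

theorem Spd.str {e : XX ≃ₜ XX} {P : XX → ℕ} (H : Spd e P) (h2 : Two e) :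
    ∃ J : XX → ℕ, Str e P J := by
  choose J hJ1 hJ2 using H.ex h2
  have U : ∀ x (j : ℕ), 1 ≤ j → j < P (e.symm (sh j x)) → J x = j := fun x j h1 h2' =>
    H.uq h2 x (hJ1 x) (hJ2 x) h1 h2'
  refine ⟨J, H, ?_, hJ1, ?_, ?_⟩
  · rw [IsLocallyConstant.iff_exists_open]
    intro x
    refine ⟨{y | P (e.symm (sh (J x) y)) = P (e.symm (sh (J x) x))}, ?_, rfl, ?_⟩
    · have := (H.lc.comp_continuous (e.symm.continuous.comp (sh_cont (J x))))
      exact this.isOpen_fiber (P (e.symm (sh (J x) x)))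
    · intro y hy
      refine U y _ (hJ1 x) ?_
      rw [show P (e.symm (sh (J x) y)) = _ from hy]
      exact hJ2 x
  · intro x hx
    have hn : J x ≠ 1 := by
      intro h1
      have := hJ2 x
      rw [h1] at this
      have e1 : sh ((1 : ℕ) : ℤ) x = e x := by rw [H.eq, hx]
      rw [e1, e.symm_apply_apply, hx] at this
      omega
    have hp := hJ1 x
    have : J (sh 1 x) = J x - 1 := by
      refine U _ _ (by omega) ?_
      rw [sh_sh, show ((J x - 1 : ℕ) : ℤ) + 1 = J x by omega]
      have := hJ2 x
      omega
    omega
  · intro x hx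
    have hp := H.pos x
    constructor
    · refine U x 1 le_rfl ?_
      have h1 := H.pos (e.symm (sh (1 : ℕ) x))
      by_contra hc
      have h1 : P (e.symm (sh (1 : ℕ) x)) = 1 := by omega
      have h2 := H.symm_eq (sh (1 : ℕ) x)
      rw [h1, sh_sh] at h2
      have h3 : e.symm (sh (1 : ℕ) x) = x := by rw [h2]; exact sh_zero x
      rw [h3] at h1
      exact hx h1
    · have : J (sh 1 x) = P x - 1 := by
        refine U _ _ (by omega) ?_
        rw [sh_sh, show ((P x - 1 : ℕ) : ℤ) + 1 = P x by omega, ← H.eq, e.symm_apply_apply]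
        omega
      omega

/-- the other strand. -/
def ta (J : XX → ℕ) (x : XX) : XX := sh (J x) x

theorem ta_one {e : XX ≃ₜ XX} {P J : XX → ℕ} (H : Str e P J) {x : XX} (h : P x = 1) :
    ta J (sh 1 x) = ta J x := by
  have := H.one x h
  unfold ta
  rw [sh_sh, this]; push_cast; rfl

theorem ta_two {e : XX ≃ₜ XX} {P J : XX → ℕ} (H : Str e P J) {x : XX} (h : P x ≠ 1) :
    ta J (sh 1 x) = e x := by
  obtain ⟨h1, h2⟩ := H.two x h
  unfold ta
  rw [sh_sh, H.eq, ← h2]; push_cast; rfl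

theorem sh_two {e : XX ≃ₜ XX} {P J : XX → ℕ} (H : Str e P J) {x : XX} (h : P x ≠ 1) :
    sh 1 x = ta J x := by
  obtain ⟨h1, h2⟩ := H.two x h
  unfold ta
  rw [h1]; rfl

theorem e_one {e : XX ≃ₜ XX} {P J : XX → ℕ} (H : Str e P J) {x : XX} (h : P x = 1) :
    e x = sh 1 x := by
  rw [H.eq, h]; rfl

theorem cont_sh_lc {K : XX → ℤ} (hK : IsLocallyConstant K) : Continuous fun x => sh (K x) x := by
  rw [continuous_iff_continuousAt]
  intro x
  refine ((sh_cont (K x)).continuousAt (x := x)).congr ?_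
  filter_upwards [hK.eventually_eq x] with y hy
  rw [hy]

theorem ta_cont {e : XX ≃ₜ XX} {P J : XX → ℕ} (H : Str e P J) : Continuous (ta J) :=
  cont_sh_lc (K := fun x => (J x : ℤ)) (H.jlc.comp (fun n : ℕ => (n : ℤ)))

/-- the affine cocycle. -/
def MM (P : XX → ℕ) (x : XX) : Aff := if P x = 1 then ⟨1, 1⟩ else ⟨-1, 0⟩

theorem MM_good (P : XX → ℕ) (x : XX) : (MM P x).Good := by
  unfold MM Aff.Good
  split_ifs <;> simp

theorem MM_win {e : XX ≃ₜ XX} {P : XX → ℕ} (H : Spd e P) : ∃ w, Win w w (MM P) :=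
  exists_win (H.lc.comp (fun n : ℕ => if n = 1 then (⟨1, 1⟩ : Aff) else ⟨-1, 0⟩))

theorem odo_F {e : XX ≃ₜ XX} {P J : XX → ℕ} (H : Str e P J) {q : ℕ} (U : XX → ZMod q)
    (hU : IsLocallyConstant U) (hUe : ∀ x, U (e x) = U x + 1) :
    ∃ F : XX → ZMod q, (∃ w, Win w w F) ∧ ∀ x, F (sh 1 x) = (MM P x).act 2 (F x) := by
  refine ⟨fun x => 2 * (U x - U (ta J x)) + 1, exists_win ?_, ?_⟩
  · have h2 := hU.comp_continuous (ta_cont H)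
    exact (hU.prodMk h2).comp fun z : ZMod q × ZMod q => 2 * (z.1 - z.2) + 1
  · intro x
    by_cases h : P x = 1
    · simp only [MM, h, if_true, Aff.act, ta_one H h]
      rw [← e_one H h, hUe]
      push_cast; ring
    · simp only [MM, h, if_false, Aff.act, ta_two H h, hUe]
      rw [sh_two H h]
      push_cast; ring

theorem s_case {e : XX ≃ₜ XX} {P J : XX → ℕ} (H : Str e P J)
    (hd : ∀ x y : XX, y ∈ closure (Set.range fun k : ℤ => (e ^ k) x))
    (s : XX → ℤ) (hs : IsLocallyConstant s) {x1 : XX} (h1 : s x1 = 1)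
    (hsM : ∀ x, s (sh 1 x) = (MM P x).e * s x) : False := by
  have hta : ∀ n : ℕ, ∀ x, J x = n → s (ta J x) = - s x := by
    intro n
    induction n with
    | zero => intro x hx; have := H.jpos x; omega
    | succ n ih =>
      intro x hx
      have hm := hsM x
      by_cases h : P x = 1
      · have h2 := H.one x h
        have := ih (sh 1 x) (by omega)
        rw [ta_one H h] at this
        rw [this, hm]; simp [MM, h]
      · rw [← sh_two H h, hm]; simp [MM, h]
  have hse : ∀ x, s (e x) = s x := by
    intro x
    have hm := hsM x
    by_cases h : P x = 1
    · rw [e_one H h, hm]; simp [MM, h]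
    · rw [← ta_two H h, hta _ _ rfl, hm]; simp [MM, h]
  have hnat : ∀ n : ℕ, ∀ x, s ((e ^ (n : ℤ)) x) = s x := by
    intro n x
    induction n with
    | zero => simp
    | succ n ih => push_cast; rw [add_comm, ← zadd, zpow_one_app, hse, ih]
  have hz : ∀ k : ℤ, ∀ x, s ((e ^ k) x) = s x := by
    intro k x
    rcases le_total 0 k with h | h
    · obtain ⟨n, rfl⟩ := Int.eq_ofNat_of_zero_le h
      exact hnat n x
    · obtain ⟨n, hn⟩ := Int.eq_ofNat_of_zero_le (show 0 ≤ -k by omega)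
      have := hnat n ((e ^ k) x)
      rw [← hn, zadd, neg_add_cancel] at this
      simpa using this.symm
  have hc : IsClosed {y | s y = 1} := hs.isClosed_fiber 1
  have hsub : Set.range (fun k : ℤ => (e ^ k) x1) ⊆ {y | s y = 1} := by
    rintro _ ⟨k, rfl⟩
    exact (hz k x1).trans h1
  have := closure_minimal hsub hc (hd x1 (ta J x1))
  have h3 : s (ta J x1) = 1 := this
  rw [hta _ _ rfl, h1] at h3
  omega

theorem strands {e : XX ≃ₜ XX} {P J : XX → ℕ} (H : Str e P J) (l : ℕ) : ∀ x : XX,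
    (∃ k : ℕ, (1 ≤ l → 1 ≤ k) ∧ sh l x = (e ^ (k : ℤ)) x) ∨
      ∃ k : ℕ, sh l x = (e ^ (k : ℤ)) (ta J x) := by
  induction l with
  | zero => intro x; left; exact ⟨0, by simp, by rw [Nat.cast_zero, sh_zero]; simp⟩
  | succ l ih =>
    intro x
    have e1 : sh ((l + 1 : ℕ) : ℤ) x = sh l (sh 1 x) := by rw [sh_sh]; push_cast; rfl
    have e2 : ∀ k : ℕ, (e ^ (k : ℤ)) (e x) = (e ^ ((k + 1 : ℕ) : ℤ)) x := by
      intro k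
      push_cast
      rw [← zadd, zpow_one_app]
    rw [e1]
    by_cases h : P x = 1
    · rcases ih (sh 1 x) with ⟨k, -, hk⟩ | ⟨k, hk⟩
      · left; exact ⟨k + 1, by omega, by rw [hk, ← e_one H h, e2]⟩
      · right; exact ⟨k, by rw [hk, ta_one H h]⟩
    · rcases ih (sh 1 x) with ⟨k, -, hk⟩ | ⟨k, hk⟩
      · right; exact ⟨k, by rw [hk, sh_two H h]⟩
      · left; exact ⟨k + 1, by omega, by rw [hk, ta_two H h, e2]⟩

theorem D_case {e : XX ≃ₜ XX} {P J : XX → ℕ} (H : Str e P J)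
    (D : XX → ℤ) (hD : IsLocallyConstant D)
    (hDM : ∀ x, D (sh 1 x) = (MM P x).e * D x + (MM P x).c) :
    ∃ h : XX ≃ₜ XX, ∀ x, h (e x) = sh 2 (h x) := by
  have hta : ∀ n : ℕ, ∀ x, J x = n → D (ta J x) = - D x - J x + 1 := by
    intro n
    induction n with
    | zero => intro x hx; have := H.jpos x; omega
    | succ n ih =>
      intro x hx
      have hm := hDM x
      by_cases h : P x = 1
      · have h2 := H.one x h
        have := ih (sh 1 x) (by omega)
        rw [ta_one H h] at this
        rw [this, hm, h2]; simp [MM, h]; ring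
      · rw [← sh_two H h, hm, (H.two x h).1]; simp [MM, h]
  have hDe : ∀ x, D (e x) = D x + 2 - P x := by
    intro x
    have hm := hDM x
    by_cases h : P x = 1
    · rw [e_one H h, hm, h]; simp [MM, h]; ring
    · rw [← ta_two H h, hta _ _ rfl, hm, ← (H.two x h).2]; simp [MM, h]; ring
  set g : XX → XX := fun x => sh (D x) x with hg
  have hge : ∀ x, g (e x) = sh 2 (g x) := by
    intro x
    simp only [hg]
    rw [hDe, H.eq, sh_sh, sh_sh]; congr 1; ring
  have hgt : ∀ x, g (ta J x) = sh (1 - 2 * D x) (g x) := by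
    intro x
    simp only [hg]
    rw [hta _ _ rfl, ta, sh_sh, sh_sh]; congr 1; ring
  have hgn : ∀ (n : ℕ) x, g ((e ^ (n : ℤ)) x) = sh (2 * n) (g x) := by
    intro n x
    induction n with
    | zero => simp [sh_zero]
    | succ n ih =>
      push_cast
      rw [add_comm, ← zadd, zpow_one_app, hge, ih, sh_sh]; congr 1; ring
  have hgc : Continuous g := cont_sh_lc hD
  have inj0 : ∀ (x : XX) (l : ℕ), g x = g (sh l x) → l = 0 := by
    intro x l hl
    rcases strands H l x with ⟨k, h1, hk⟩ | ⟨k, hk⟩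
    · rw [hk, hgn] at hl
      have := sh_aper hl.symm
      omega
    · rw [hk, hgn, hgt, sh_sh] at hl
      have := sh_aper hl.symm
      omega
  have hinj : Function.Injective g := by
    intro x y hxy
    have hy : y = sh (-D y + D x) x := by
      rw [← sh_sh]; exact sh_cancel hxy.symm
    rcases le_total 0 (-D y + D x) with h | h
    · obtain ⟨n, hn⟩ := Int.eq_ofNat_of_zero_le h
      rw [hn] at hy
      have := inj0 x n (by rw [← hy, hxy])
      rw [this] at hy
      rw [hy]; exact (sh_zero x).symm
    · obtain ⟨n, hn⟩ := Int.eq_ofNat_of_zero_le (show 0 ≤ -(-D y + D x) by omega)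
      have hx := sh_cancel hy.symm
      rw [hn] at hx
      have := inj0 y n (by rw [← hx, hxy])
      rw [this] at hx
      rw [hx]; exact sh_zero y
  have hp2 : ∀ y ∈ Set.range g, sh 2 y ∈ Set.range g := by
    rintro _ ⟨x, rfl⟩; exact ⟨e x, hge x⟩
  have hm2 : ∀ y ∈ Set.range g, sh (-2) y ∈ Set.range g := by
    rintro _ ⟨x, rfl⟩
    refine ⟨e.symm x, ?_⟩
    have := hge (e.symm x)
    rw [e.apply_symm_apply] at this
    exact sh_cancel this.symm
  have hev : ∀ (n : ℕ), ∀ y ∈ Set.range g, sh (2 * n) y ∈ Set.range g ∧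
      sh (-(2 * n)) y ∈ Set.range g := by
    intro n y hy
    induction n with
    | zero => simpa [sh_zero] using hy
    | succ n ih =>
      have a := hp2 _ ih.1
      have b := hm2 _ ih.2
      rw [sh_sh] at a b
      constructor
      · convert a using 2; push_cast; ring
      · convert b using 2; push_cast; ring
  have hevz : ∀ (n : ℤ), ∀ y ∈ Set.range g, sh (2 * n) y ∈ Set.range g := by
    intro n y hy
    rcases le_total 0 n with h | h
    · obtain ⟨m, rfl⟩ := Int.eq_ofNat_of_zero_le h
      exact (hev m y hy).1
    · obtain ⟨m, hn⟩ := Int.eq_ofNat_of_zero_le (show 0 ≤ -n by omega)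
      convert (hev m y hy).2 using 2
      omega
  have hall : ∀ (n : ℤ), ∀ y ∈ Set.range g, sh n y ∈ Set.range g := by
    rintro n _ ⟨x, rfl⟩
    rcases Int.even_or_odd' n with ⟨m, rfl | rfl⟩
    · exact hevz m _ ⟨x, rfl⟩
    · have := hevz (m + D x) _ ⟨ta J x, rfl⟩
      rw [hgt, sh_sh] at this
      convert this using 2; ring
  have hsurj : Function.Surjective g := by
    intro x
    have := hall (-D x) _ ⟨x, rfl⟩
    rwa [← sh_cancel (rfl : sh (D x) x = g x)] at this
  refine ⟨Continuous.homeoOfEquivCompactToT2 (f := Equiv.ofBijective g ⟨hinj, hsurj⟩) hgc, ?_⟩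
  exact hge

theorem core {e : XX ≃ₜ XX} {P : XX → ℕ} (H : Spd e P) (h2 : Two e)
    (hd : ∀ x y : XX, y ∈ closure (Set.range fun k : ℤ => (e ^ k) x))
    (x0 : XX) (hrec : ∀ O ∈ 𝓝 x0, ∃ m : ℕ, 0 < m ∧ ∀ k : ℤ, (e ^ (k * (m : ℤ))) x0 ∈ O) :
    ∃ h : XX ≃ₜ XX, ∀ x, h (e x) = sh 2 (h x) := by
  obtain ⟨J, HJ⟩ := H.str h2
  have haper0 : ∀ n : ℕ, n ≠ 0 → (e ^ (n : ℤ)) x0 ≠ x0 := by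
    intro n hn h
    obtain ⟨i, hi, h'⟩ := H.nat n x0
    have := sh_aper (h'.symm.trans h)
    omega
  have haper : ∀ n : ℤ, n ≠ 0 → (e ^ n) x0 ≠ x0 := by
    intro n hn h
    rcases le_total 0 n with h' | h'
    · obtain ⟨m, rfl⟩ := Int.eq_ofNat_of_zero_le h'
      exact haper0 m (by omega) h
    · obtain ⟨m, hm⟩ := Int.eq_ofNat_of_zero_le (show 0 ≤ -n by omega)
      refine haper0 m (by omega) ?_
      rw [← hm]
      nth_rw 1 [← h]
      rw [zadd]; simp
  rcases main_alg x0 (MM P) (MM_win H) (MM_good P) (fun N => by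
    obtain ⟨q, hq, U, hU, hUe⟩ := odometer_factor e x0 hrec (hd x0) haper N
    exact ⟨q, hq, odo_F HJ U hU hUe⟩) with ⟨s, ⟨w, hw⟩, ⟨x1, h1⟩, hs⟩ | ⟨D, ⟨w, hw⟩, hD⟩
  · exact (s_case HJ hd s hw.lc h1 hs).elim
  · exact D_case HJ D hw.lc hD

end ChiSpeedup

namespace ChiSpeedup

theorem shiftMap_iter {A : Type} (k : ℕ) (x : ℤ → A) : shiftMap^[k] x = shiftZ k x := by
  induction k with
  | zero => funext m; simp [shiftZ]
  | succ k ih =>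
    rw [Function.iterate_succ_apply', ih]
    funext m
    simp only [shiftMap, shiftZ]
    congr 1; push_cast; ring

theorem iter_val {S : (ℤ → Fin 2) → (ℤ → Fin 2)} {e : XX ≃ₜ XX} (he : ∀ x : XX, (e x).1 = S x.1)
    (n : ℕ) (x : XX) : S^[n] x.1 = ((e ^ (n : ℤ)) x).1 := by
  induction n with
  | zero => simp
  | succ n ih =>
    rw [Function.iterate_succ_apply', ih, ← he]
    push_cast
    rw [add_comm, ← zadd, zpow_one_app]

theorem mem_orbitIn {S : (ℤ → Fin 2) → (ℤ → Fin 2)} {e : XX ≃ₜ XX}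
    (he : ∀ x : XX, (e x).1 = S x.1) (x y : XX) :
    y.1 ∈ orbitIn S (substShift chi) x.1 ↔ SO e x y := by
  constructor
  · rintro ⟨-, n, h | h⟩
    · rw [iter_val he] at h
      exact ⟨n, Subtype.ext h⟩
    · rw [iter_val he] at h
      exact SO.symm ⟨n, Subtype.ext h⟩
  · rintro ⟨k, hk⟩
    refine ⟨y.2, ?_⟩
    rcases le_total 0 k with h | h
    · obtain ⟨m, rfl⟩ := Int.eq_ofNat_of_zero_le h
      refine ⟨m, Or.inl ?_⟩
      rw [iter_val he]; exact congrArg _ hk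
    · obtain ⟨m, hm⟩ := Int.eq_ofNat_of_zero_le (show 0 ≤ -k by omega)
      refine ⟨m, Or.inr ?_⟩
      rw [iter_val he, ← hk, ← hm, zadd]; simp

theorem mem_orbitIn_shift (x y : XX) :
    y.1 ∈ orbitIn shiftMap (substShift chi) x.1 ↔ ∃ m : ℤ, y = sh m x := by
  constructor
  · rintro ⟨-, n, h | h⟩
    · rw [shiftMap_iter] at h
      exact ⟨n, Subtype.ext h.symm⟩
    · rw [shiftMap_iter] at h
      exact ⟨-n, sh_cancel (Subtype.ext h)⟩
  · rintro ⟨k, rfl⟩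
    refine ⟨(sh k x).2, ?_⟩
    rcases le_total 0 k with h | h
    · obtain ⟨m, rfl⟩ := Int.eq_ofNat_of_zero_le h
      exact ⟨m, Or.inl (shiftMap_iter m _)⟩
    · obtain ⟨m, hm⟩ := Int.eq_ofNat_of_zero_le (show 0 ≤ -k by omega)
      refine ⟨m, Or.inr ?_⟩
      rw [shiftMap_iter, ← hm]
      exact congrArg Subtype.val (sh_cancel (rfl : sh k x = _)).symm

theorem toeplitz_rec {B : Type} [TopologicalSpace B] [DiscreteTopology B] {z : ℤ → B}
    (hz : IsToeplitz z) {O : Set (ℤ → B)} (hO : O ∈ 𝓝 z) :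
    ∃ m : ℕ, 0 < m ∧ ∀ k : ℤ, shiftZ (k * (m : ℤ)) z ∈ O := by
  obtain ⟨V, hVO, hV, hzV⟩ := mem_nhds_iff.1 hO
  obtain ⟨I, u, hu, hI⟩ := isOpen_pi_iff.1 hV z hzV
  choose p hp0 hp using hz
  refine ⟨∏ i ∈ I, p i, Finset.prod_pos fun i _ => hp0 i, fun k => hVO (hI ?_)⟩
  intro i hi
  obtain ⟨c, hc⟩ := Finset.dvd_prod_of_mem p (show i ∈ I from hi)
  have : shiftZ (k * ((∏ i ∈ I, p i : ℕ) : ℤ)) z i = z i := by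
    unfold shiftZ
    rw [hc, ← hp i (k * c)]
    congr 1; push_cast; ring
  rw [this]
  exact (hu i hi).2

theorem toeplitz_point {S : (ℤ → Fin 2) → (ℤ → Fin 2)} {e : XX ≃ₜ XX}
    (he : ∀ x : XX, (e x).1 = S x.1) (ht : IsToeplitzFlow (substShift chi) S) :
    ∃ x0 : XX, ∀ O ∈ 𝓝 x0, ∃ m : ℕ, 0 < m ∧ ∀ k : ℤ, (e ^ (k * (m : ℤ))) x0 ∈ O := by
  obtain ⟨B, _, z, hz, hT⟩ := ht
  let _ : TopologicalSpace B := ⊥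
  have : DiscreteTopology B := ⟨rfl⟩
  obtain ⟨hS, hR, h, hh⟩ := hT
  have hzm : z ∈ orbitClosure z := subset_closure ⟨0, by funext m; simp [shiftZ]⟩
  have h1 : ∀ x : XX, (h (e x)).1 = shiftMap (h x).1 := by
    intro x
    have := congrArg Subtype.val (hh x)
    have e1 : Set.MapsTo.restrict S _ _ hS x = e x := Subtype.ext (he x).symm
    rw [e1] at this
    exact this
  have hnat : ∀ (n : ℕ) (x : XX), (h ((e ^ (n : ℤ)) x)).1 = shiftZ n (h x).1 := by
    intro n x
    induction n with
    | zero => funext m; simp [shiftZ]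
    | succ n ih =>
      push_cast
      rw [add_comm, ← zadd, zpow_one_app, h1, ih]
      funext m
      simp only [shiftMap, shiftZ]
      ring_nf
  have hzpow : ∀ (k : ℤ) (x : XX), (h ((e ^ k) x)).1 = shiftZ k (h x).1 := by
    intro k x
    rcases le_total 0 k with hk | hk
    · obtain ⟨n, rfl⟩ := Int.eq_ofNat_of_zero_le hk
      exact hnat n x
    · obtain ⟨n, hn⟩ := Int.eq_ofNat_of_zero_le (show 0 ≤ -k by omega)
      have := hnat n ((e ^ k) x)
      rw [← hn, zadd, neg_add_cancel] at this
      have h0 : (h x).1 = shiftZ (-k) (h ((e ^ k) x)).1 := by simpa using this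
      rw [h0]
      funext m
      simp [shiftZ]
  refine ⟨h.symm ⟨z, hzm⟩, fun O hO => ?_⟩
  have hO' : h.symm ⁻¹' O ∈ 𝓝 (⟨z, hzm⟩ : orbitClosure z) :=
    h.symm.continuous.continuousAt hO
  rw [nhds_subtype_eq_comap, Filter.mem_comap] at hO'
  obtain ⟨V, hV, hVO⟩ := hO'
  obtain ⟨m, hm, hk⟩ := toeplitz_rec hz hV
  refine ⟨m, hm, fun k => ?_⟩
  have h2 : h ((e ^ (k * (m : ℤ))) (h.symm ⟨z, hzm⟩)) ∈ h.symm ⁻¹' O := by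
    apply hVO
    show (h ((e ^ (k * (m : ℤ))) (h.symm ⟨z, hzm⟩))).1 ∈ V
    rw [hzpow, h.apply_symm_apply]
    exact hk k
  simpa using h2

end ChiSpeedup

/-- every minimal bounded speedup of (X_χ, σ) with orbit number 2 which is
a Toeplitz flow is topologically conjugate to (X_χ, σ²). -/
theorem statement12 (p : (ℤ → Fin 2) → ℕ)
    (hpos : ∀ x ∈ substShift chi, 1 ≤ p x)
    (hcont : ContinuousOn p (substShift chi))
    (hhomeo : RestrictsToHomeomorph (fun x => shiftMap^[p x] x) (substShift chi))
    (hmin : MinimalOn (fun x => shiftMap^[p x] x) (substShift chi))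
    (horb : OrbitNumberOn shiftMap (fun x => shiftMap^[p x] x) (substShift chi) 2)
    (htoep : IsToeplitzFlow (substShift chi) (fun x => shiftMap^[p x] x)) :
    TopConj (substShift chi) (fun x => shiftMap^[p x] x)
      (substShift chi) (shiftMap^[2]) := by
  open ChiSpeedup in
  obtain ⟨e, he⟩ := hhomeo
  have H : Spd e (fun x => p x.1) := by
    refine ⟨fun x => hpos x.1 x.2, fun x => Subtype.ext ?_, ?_⟩
    · rw [he]; exact shiftMap_iter _ _
    · exact (IsLocallyConstant.iff_continuous _).2 (continuousOn_iff_continuous_domRestrict.1 hcont)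
  have h2 : Two e := by
    intro x
    obtain ⟨r, hr1, hr2, hr3⟩ := horb x.1 x.2
    refine ⟨fun i => ⟨r i, (hr1 i).1⟩, fun i => (mem_orbitIn_shift x ⟨r i, (hr1 i).1⟩).1 (hr1 i),
      fun hc => hr2 0 1 (by decide) ((mem_orbitIn he ⟨r 0, (hr1 0).1⟩ ⟨r 1, (hr1 1).1⟩).2 hc),
      fun m => ?_⟩
    obtain ⟨i, hi⟩ := hr3 (sh m x).1 ((mem_orbitIn_shift x (sh m x)).2 ⟨m, rfl⟩)
    exact ⟨i, (mem_orbitIn he ⟨r i, (hr1 i).1⟩ (sh m x)).1 hi⟩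
  have hd : ∀ x y : XX, y ∈ closure (Set.range fun k : ℤ => (e ^ k) x) := by
    intro x y
    rw [closure_subtype]
    refine closure_mono ?_ (hmin x.1 x.2 y.2)
    intro w hw
    obtain ⟨k, hk⟩ := (mem_orbitIn he x ⟨w, hw.1⟩).1 hw
    exact ⟨⟨w, hw.1⟩, ⟨k, hk⟩, rfl⟩
  obtain ⟨x0, hrec⟩ := toeplitz_point he htoep
  obtain ⟨h, hh⟩ := core H h2 hd x0 hrec
  refine ⟨fun x hx => ?_, fun x hx => ?_, h, fun x => ?_⟩
  · have := (e ⟨x, hx⟩).2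
    rw [he] at this
    exact this
  · rw [shiftMap_iter]; exact shiftZ_mem hx _
  · have e1 : Set.MapsTo.restrict (fun x => shiftMap^[p x] x) (substShift chi) (substShift chi)
        (fun x hx => by
          have := (e ⟨x, hx⟩).2
          rw [he] at this
          exact this) x = e x := Subtype.ext (he x).symm
    rw [e1, hh]
    apply Subtype.ext
    exact (shiftMap_iter 2 _).symm

end
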